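/- arXiv:0803.4280 — 2 statements merged into one kernel-verified Lean document; each statement's English description precedes it below -/
import Mathlib

section
/- Let d ≥ 1 and let ψ, μ : FreeAlgebra ℝ (Fin d) → ℝ be linear functionals, star-compatible (ψ(star p) = ψ(p), μ(star p) = μ(p) for all p), with ψ(1) = 1, ψ(star(p)·p) ≥ 0 for all p, and μ(star(p)·p) ≥ 0 for all p with ε(p) = 0. Let η : FreeAlgebra ℝ (Fin d) → ℝ be the unique linear functional with η(1) = 1 and, for every n ≥ 1 and every word x_{u(1)}⋯x_{u(n)} in the generators, η(x_{u(1)}⋯x_{u(n)}) = Σ over all l ≥ 1 and all index sequences 1 = v(1) < v(2) < ⋯ < v(l) = n of μ(x_{u(v(1))}·x_{u(v(2))}⋯x_{u(v(l))}) · ∏_{r=1}^{l−1} ψ(x_{u(v(r)+1)}⋯x_{u(v(r+1)−1)}), where a factor corresponding to an empty gap (v(r+1) = v(r)+1) is ψ(1) = 1, and for n = 1 the sum is the single term μ(x_{u(1)}). Then η is conditionally positive definite: η(star(p)·p) ≥ 0 for every p with ε(p) = 0. -/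
/-- The word `x_{u(a)} x_{u(a+1)} ⋯ x_{u(b-1)}` in the free algebra
(the empty product `1` if `b ≤ a`). -/
noncomputable def word (d : ℕ) (u : ℕ → Fin d) (a b : ℕ) :
    FreeAlgebra ℝ (Fin d) :=
  ((List.range' a (b - a)).map fun i => FreeAlgebra.ι ℝ (u i)).prod

/-- The constant-term homomorphism `ε`, sending each generator to `0`. -/
noncomputable def constTerm (d : ℕ) : FreeAlgebra ℝ (Fin d) →ₐ[ℝ] ℝ :=
  FreeAlgebra.lift ℝ (fun _ : Fin d => (0 : ℝ))

open scoped TensorProduct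

/-- A bilinear form that is symmetric, and nonnegative on a submodule, has positive semidefinite
Gram matrices there. -/
lemma posSemidef_gram_of_nonneg {U : Type*} [AddCommGroup U] [Module ℝ U]
    (B : LinearMap.BilinForm ℝ U) (hs : ∀ x y, B x y = B y x) (J : Submodule ℝ U)
    (hJ : ∀ x ∈ J, 0 ≤ B x x) {k : ℕ} (f : Fin k → U) (hf : ∀ i, f i ∈ J) :
    (Matrix.of fun i j => B (f i) (f j)).PosSemidef := by
  rw [Matrix.posSemidef_iff_dotProduct_mulVec]
  refine ⟨Matrix.IsHermitian.ext fun i j => by simp [hs (f i) (f j)], fun c => ?_⟩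
  have h := hJ (∑ i, c i • f i) (J.sum_mem fun i _ => J.smul_mem _ (hf i))
  simp only [map_sum, map_smul, LinearMap.sum_apply, LinearMap.smul_apply, smul_eq_mul] at h
  simp only [dotProduct, Matrix.mulVec, Matrix.of_apply, Pi.star_apply, star_trivial]
  refine h.trans_eq (Finset.sum_congr rfl fun i _ => ?_)
  congr 1
  exact Finset.sum_congr rfl fun j _ => by rw [hs (f j) (f i), mul_comm]

/-- The tensor product of two symmetric bilinear forms, nonnegative on `V` and on a submodule `I`
of `W` respectively, is nonnegative on the image of `V ⊗ I`. -/
lemma tmul_self_nonneg_of_mem_range_lTensor {V W : Type*} [AddCommGroup V] [Module ℝ V]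
    [AddCommGroup W] [Module ℝ W] (B₁ : LinearMap.BilinForm ℝ V) (B₂ : LinearMap.BilinForm ℝ W)
    (hs₁ : ∀ x y, B₁ x y = B₁ y x) (hs₂ : ∀ x y, B₂ x y = B₂ y x)
    (I : Submodule ℝ W) (h₁ : ∀ x, 0 ≤ B₁ x x) (h₂ : ∀ x ∈ I, 0 ≤ B₂ x x)
    {t : V ⊗[ℝ] W} (ht : t ∈ LinearMap.range (I.subtype.lTensor V)) :
    0 ≤ (B₁.tmul B₂) t t := by
  obtain ⟨s, rfl⟩ := ht
  obtain ⟨k, v, w, rfl⟩ := TensorProduct.exists_sum_tmul_eq s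
  have h := ((posSemidef_gram_of_nonneg B₁ hs₁ ⊤ (fun x _ => h₁ x) v fun _ => trivial).hadamard
    (posSemidef_gram_of_nonneg B₂ hs₂ I h₂ (fun i => (w i : W))
      fun i => (w i).2)).dotProduct_mulVec_nonneg (fun _ => 1)
  simp only [dotProduct, Matrix.mulVec, Matrix.hadamard_apply, Matrix.of_apply, Pi.star_apply,
    star_trivial, one_mul, mul_one] at h
  simp only [map_sum, LinearMap.sum_apply, LinearMap.lTensor_tmul, Submodule.subtype_apply,
    LinearMap.BilinForm.tensorDistrib_tmul]
  rw [Finset.sum_comm] at h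
  simpa [mul_comm] using h

section

variable {d : ℕ}

/-- The bilinear form `(x, y) ↦ φ (x⋆ y)` of a functional on the free algebra. -/
noncomputable def gramForm (φ : FreeAlgebra ℝ (Fin d) →ₗ[ℝ] ℝ) :
    LinearMap.BilinForm ℝ (FreeAlgebra ℝ (Fin d)) :=
  LinearMap.mk₂ ℝ (fun x y => φ (star x * y))
    (by intros; simp [add_mul])
    (by
      intro c x y
      rw [Algebra.smul_def, star_mul, FreeAlgebra.star_algebraMap, ← Algebra.commutes,
        ← Algebra.smul_def, smul_mul_assoc, map_smul])
    (by intros; simp [mul_add])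
    (by intros; simp)

@[simp]
lemma gramForm_apply (φ : FreeAlgebra ℝ (Fin d) →ₗ[ℝ] ℝ) (x y : FreeAlgebra ℝ (Fin d)) :
    gramForm φ x y = φ (star x * y) := rfl

lemma gramForm_symm {φ : FreeAlgebra ℝ (Fin d) →ₗ[ℝ] ℝ} (hφ : ∀ p, φ (star p) = φ p)
    (x y : FreeAlgebra ℝ (Fin d)) : gramForm φ x y = gramForm φ y x := by
  simp [← hφ (star x * y)]

/-- The contraction `a ⊗ b ↦ ψ(a) b`. -/
noncomputable def contract (ψ : FreeAlgebra ℝ (Fin d) →ₗ[ℝ] ℝ) :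
    FreeAlgebra ℝ (Fin d) ⊗[ℝ] FreeAlgebra ℝ (Fin d) →ₗ[ℝ] FreeAlgebra ℝ (Fin d) :=
  (TensorProduct.lid ℝ _).toLinearMap ∘ₗ ψ.rTensor _

@[simp]
lemma contract_tmul (ψ : FreeAlgebra ℝ (Fin d) →ₗ[ℝ] ℝ) (a b : FreeAlgebra ℝ (Fin d)) :
    contract ψ (a ⊗ₜ b) = ψ a • b := by
  simp [contract]

/-- The representation of the free algebra in which a generator `x` acts by
`a ⊗ b ↦ x a ⊗ b + ψ(a) 1 ⊗ x b`. -/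
noncomputable def gapRep (ψ : FreeAlgebra ℝ (Fin d) →ₗ[ℝ] ℝ) :
    FreeAlgebra ℝ (Fin d) →ₐ[ℝ]
      Module.End ℝ (FreeAlgebra ℝ (Fin d) ⊗[ℝ] FreeAlgebra ℝ (Fin d)) :=
  FreeAlgebra.lift ℝ fun i =>
    (LinearMap.mulLeft ℝ (FreeAlgebra.ι ℝ i)).rTensor _ +
      TensorProduct.mk ℝ _ _ 1 ∘ₗ LinearMap.mulLeft ℝ (FreeAlgebra.ι ℝ i) ∘ₗ contract ψ

lemma gapRep_ι_tmul (ψ : FreeAlgebra ℝ (Fin d) →ₗ[ℝ] ℝ) (i : Fin d)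
    (a b : FreeAlgebra ℝ (Fin d)) :
    gapRep ψ (FreeAlgebra.ι ℝ i) (a ⊗ₜ b) =
      (FreeAlgebra.ι ℝ i * a) ⊗ₜ b + ψ a • (1 ⊗ₜ (FreeAlgebra.ι ℝ i * b)) := by
  simp [gapRep]

/-- `gapRep ψ` preserves the image of `A ⊗ ker ε`. -/
lemma gapRep_mem_range (ψ : FreeAlgebra ℝ (Fin d) →ₗ[ℝ] ℝ) (q : FreeAlgebra ℝ (Fin d)) :
    ∀ t ∈ LinearMap.range
        ((LinearMap.ker (constTerm d).toLinearMap).subtype.lTensor (FreeAlgebra ℝ (Fin d))),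
      gapRep ψ q t ∈ LinearMap.range
        ((LinearMap.ker (constTerm d).toLinearMap).subtype.lTensor (FreeAlgebra ℝ (Fin d))) := by
  induction q using FreeAlgebra.induction with
  | grade0 r =>
    intro t ht
    simpa [AlgHom.commutes, Module.algebraMap_end_apply] using Submodule.smul_mem _ r ht
  | grade1 i =>
    rintro _ ⟨s, rfl⟩
    induction s using TensorProduct.induction_on with
    | zero => simp
    | add s₁ s₂ h₁ h₂ => simpa only [map_add] using Submodule.add_mem _ h₁ h₂
    | tmul a b =>
      rw [LinearMap.lTensor_tmul, gapRep_ι_tmul]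
      refine Submodule.add_mem _ ⟨(FreeAlgebra.ι ℝ i * a) ⊗ₜ b, rfl⟩ (Submodule.smul_mem _ _
        ⟨1 ⊗ₜ ⟨FreeAlgebra.ι ℝ i * b, ?_⟩, rfl⟩)
      have hb : constTerm d b = 0 := b.2
      simp [hb]
  | mul p q hp hq =>
    intro t ht
    simpa only [map_mul, Module.End.mul_apply] using hp _ (hq _ ht)
  | add p q hp hq =>
    intro t ht
    simpa only [map_add, LinearMap.add_apply] using Submodule.add_mem _ (hp _ ht) (hq _ ht)

/-- `gapRep ψ` is a `⋆`-representation for the form `ψ ⊗ μ`. -/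
lemma gapRep_adjoint {ψ : FreeAlgebra ℝ (Fin d) →ₗ[ℝ] ℝ} (μ : FreeAlgebra ℝ (Fin d) →ₗ[ℝ] ℝ)
    (hψ : ∀ p, ψ (star p) = ψ p) (q : FreeAlgebra ℝ (Fin d)) :
    ∀ s t, ((gramForm ψ).tmul (gramForm μ)) (gapRep ψ q s) t =
      ((gramForm ψ).tmul (gramForm μ)) s (gapRep ψ (star q) t) := by
  induction q using FreeAlgebra.induction with
  | grade0 r =>
    intro s t
    simp only [FreeAlgebra.star_algebraMap, AlgHom.commutes, Module.algebraMap_end_apply,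
      map_smul, LinearMap.smul_apply]
  | grade1 i =>
    intro s t
    rw [FreeAlgebra.star_ι]
    induction s using TensorProduct.induction_on with
    | zero => simp
    | add s₁ s₂ h₁ h₂ => simp only [map_add, LinearMap.add_apply, h₁, h₂]
    | tmul a b =>
      induction t using TensorProduct.induction_on with
      | zero => simp
      | add t₁ t₂ h₁ h₂ => simp only [map_add, h₁, h₂]
      | tmul a' b' =>
        simp only [gapRep_ι_tmul, map_add, map_smul, LinearMap.add_apply, LinearMap.smul_apply,
          LinearMap.BilinForm.tensorDistrib_tmul, gramForm_apply, star_mul, FreeAlgebra.star_ι,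
          star_one, one_mul, mul_one, hψ, smul_eq_mul, mul_assoc]
        ring
  | mul p q hp hq =>
    intro s t
    rw [map_mul, Module.End.mul_apply, hp, hq, star_mul, map_mul, Module.End.mul_apply]
  | add p q hp hq =>
    intro s t
    simp only [map_add, star_add, LinearMap.add_apply, hp, hq]

/-- Every element is its constant term plus a left combination of the generators. -/
lemma exists_eq_constTerm_add_sum (p : FreeAlgebra ℝ (Fin d)) :
    ∃ q : Fin d → FreeAlgebra ℝ (Fin d),
      p = algebraMap ℝ _ (constTerm d p) + ∑ i, q i * FreeAlgebra.ι ℝ i := by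
  induction p using FreeAlgebra.induction with
  | grade0 r => exact ⟨0, by simp⟩
  | grade1 i => exact ⟨Pi.single i 1, by simp [constTerm, Pi.single_apply]⟩
  | mul p p' hp hp' =>
    obtain ⟨q, hq⟩ := hp
    obtain ⟨q', hq'⟩ := hp'
    refine ⟨fun i => constTerm d p' • q i + p * q' i, ?_⟩
    simp only [add_mul, Finset.sum_add_distrib, mul_assoc, ← Finset.mul_sum, smul_mul_assoc,
      ← Finset.smul_sum]
    rw [← add_assoc, map_mul, map_mul, ← Algebra.commutes, ← Algebra.smul_def, ← smul_add, ← hq]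
    conv_lhs => rw [hq', mul_add, ← Algebra.commutes, ← Algebra.smul_def]
  | add p p' hp hp' =>
    obtain ⟨q, hq⟩ := hp
    obtain ⟨q', hq'⟩ := hp'
    refine ⟨q + q', ?_⟩
    simp only [Pi.add_apply, add_mul, Finset.sum_add_distrib, map_add]
    conv_lhs => rw [hq, hq']
    abel

/-- Two functionals on the free algebra agree if they agree on words. -/
lemma linearMap_ext_words {f g : FreeAlgebra ℝ (Fin d) →ₗ[ℝ] ℝ}
    (h : ∀ l : List (Fin d), f (l.map (FreeAlgebra.ι ℝ)).prod = g (l.map (FreeAlgebra.ι ℝ)).prod) :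
    f = g := by
  refine (FreeAlgebra.basisFreeMonoid ℝ (Fin d)).ext fun l => ?_
  have : FreeAlgebra.basisFreeMonoid ℝ (Fin d) l =
      (l.toList.map (FreeAlgebra.ι ℝ)).prod := by
    simp [FreeAlgebra.basisFreeMonoid, FreeAlgebra.equivMonoidAlgebraFreeMonoid,
      FreeMonoid.lift_apply]
  rw [this, h]

lemma word_eq_mul (u : ℕ → Fin d) {a b : ℕ} (h : a < b) :
    word d u a b = FreeAlgebra.ι ℝ (u a) * word d u (a + 1) b := by
  obtain ⟨k, rfl⟩ := Nat.exists_eq_add_of_lt h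
  simp [word, show a + k + 1 - a = k + 1 by omega, show a + k + 1 - (a + 1) = k by omega,
    List.range'_succ]

lemma word_self (u : ℕ → Fin d) (a : ℕ) : word d u a a = 1 := by
  simp [word]

/-- The product of the generators picked by `l`, weighted by the values of `ψ` on the gaps. -/
noncomputable def weightedPick (ψ : FreeAlgebra ℝ (Fin d) →ₗ[ℝ] ℝ) (u : ℕ → Fin d) (l : List ℕ) :
    FreeAlgebra ℝ (Fin d) :=
  ((List.zip l l.tail).map fun p => ψ (word d u (p.1 + 1) p.2)).prod •
    (l.map fun i => FreeAlgebra.ι ℝ (u i)).prod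

lemma weightedPick_cons (ψ : FreeAlgebra ℝ (Fin d) →ₗ[ℝ] ℝ) (u : ℕ → Fin d) (a : ℕ) {l : List ℕ}
    (hl : l ≠ []) :
    weightedPick ψ u (a :: l) =
      ψ (word d u (a + 1) (l.headD 0)) • (FreeAlgebra.ι ℝ (u a) * weightedPick ψ u l) := by
  obtain ⟨b, l, rfl⟩ := List.exists_cons_of_ne_nil hl
  simp [weightedPick, smul_smul]

/-- The action of a word on its last letter, as a sum over the subsets containing that letter. -/
lemma gapRep_word_tmul (ψ : FreeAlgebra ℝ (Fin d) →ₗ[ℝ] ℝ) (u : ℕ → Fin d) (k : ℕ) : ∀ a,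
    gapRep ψ (word d u a (a + k)) (1 ⊗ₜ FreeAlgebra.ι ℝ (u (a + k))) =
      ∑ Λ ∈ (Finset.Ico a (a + k + 1)).powerset with a + k ∈ Λ,
        word d u a ((Λ.sort (· ≤ ·)).headD 0) ⊗ₜ weightedPick ψ u (Λ.sort (· ≤ ·)) := by
  induction k with
  | zero =>
    intro a
    have : ((Finset.Ico a (a + 0 + 1)).powerset.filter (a + 0 ∈ ·)) = {{a}} := by
      ext Λ
      simp only [add_zero, Nat.Ico_succ_singleton, Finset.mem_filter, Finset.mem_powerset,
        Finset.subset_singleton_iff, Finset.mem_singleton]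
      constructor
      · rintro ⟨rfl | rfl, h⟩ <;> simp_all
      · rintro rfl; simp
    rw [this]
    simp [word_self, weightedPick]
  | succ k ih =>
    intro a
    have ha : a ∉ Finset.Ico (a + 1) (a + 1 + k + 1) := by simp
    have hI : Finset.Ico a (a + (k + 1) + 1) = insert a (Finset.Ico (a + 1) (a + 1 + k + 1)) := by
      ext i; simp; omega
    have hk : a + (k + 1) = a + 1 + k := by ring
    rw [word_eq_mul u (by omega), map_mul, Module.End.mul_apply, Finset.sum_filter, hI, hk, ih,
      Finset.sum_powerset_insert ha, ← Finset.sum_add_distrib, map_sum, Finset.sum_filter]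
    refine Finset.sum_congr rfl fun Λ hΛ => ?_
    have hne : a + 1 + k ≠ a := by omega
    simp only [Finset.mem_insert, hne, false_or]
    split_ifs with hmem
    · have hlt : ∀ b ∈ Λ, a + 1 ≤ b := fun b hb =>
        (Finset.mem_Ico.1 (Finset.mem_powerset.1 hΛ hb)).1
      have haΛ : a ∉ Λ := fun h => absurd (hlt a h) (by omega)
      have hnil : Λ.sort (· ≤ ·) ≠ [] := by
        intro h
        have := (Finset.mem_sort (· ≤ ·)).2 hmem
        simp [h] at this
      have hhead : a < (Λ.sort (· ≤ ·)).headD 0 := by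
        obtain ⟨b, l, hbl⟩ := List.exists_cons_of_ne_nil hnil
        have : b ∈ Λ := (Finset.mem_sort (· ≤ ·)).1 (by rw [hbl]; simp)
        simpa [hbl] using hlt b this
      rw [Finset.sort_insert _ (fun b hb => by have := hlt b hb; omega) haΛ, gapRep_ι_tmul,
        weightedPick_cons ψ u a hnil, word_eq_mul u hhead]
      simp [word_self]
    · simp

/-- The sum over subsets containing both ends, in terms of `gapRep`. -/
lemma sum_subsets_eq (ψ μ : FreeAlgebra ℝ (Fin d) →ₗ[ℝ] ℝ) (u : ℕ → Fin d) (k : ℕ) :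
    (∑ Λ ∈ (Finset.range (k + 2)).powerset.filter (fun Λ => 0 ∈ Λ ∧ k + 2 - 1 ∈ Λ),
      μ (((Λ.sort (· ≤ ·)).map fun i => FreeAlgebra.ι ℝ (u i)).prod) *
        ((List.zip (Λ.sort (· ≤ ·)) (Λ.sort (· ≤ ·)).tail).map
          fun p => ψ (word d u (p.1 + 1) p.2)).prod) =
    μ (FreeAlgebra.ι ℝ (u 0) *
      contract ψ (gapRep ψ (word d u 1 (k + 1)) (1 ⊗ₜ FreeAlgebra.ι ℝ (u (k + 1))))) := by
  have hI : Finset.range (k + 2) = insert 0 (Finset.Ico 1 (1 + k + 1)) := by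
    ext i; simp; omega
  rw [add_comm k 1, gapRep_word_tmul, Finset.sum_filter, hI, Finset.sum_powerset_insert (by simp),
    Finset.sum_filter, map_sum, Finset.mul_sum, map_sum, ← Finset.sum_add_distrib]
  refine Finset.sum_congr rfl fun Λ hΛ => ?_
  have hlt : ∀ b ∈ Λ, 1 ≤ b := fun b hb => (Finset.mem_Ico.1 (Finset.mem_powerset.1 hΛ hb)).1
  have h0 : 0 ∉ Λ := fun h => absurd (hlt 0 h) (by omega)
  simp only [h0, false_and, if_false, zero_add, Finset.mem_insert, true_or, true_and,
    show k + 2 - 1 = 1 + k by omega, show 1 + k ≠ 0 by omega, false_or]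
  split_ifs with hmem
  · have hnil : Λ.sort (· ≤ ·) ≠ [] := by
      intro h
      have := (Finset.mem_sort (· ≤ ·)).2 hmem
      simp [h] at this
    have h := weightedPick_cons ψ u 0 hnil
    rw [contract_tmul, mul_smul_comm, ← zero_add 1, ← h,
      Finset.sort_insert _ (fun b _ => Nat.zero_le b) h0, weightedPick, map_smul, smul_eq_mul,
      mul_comm]
  · simp

end

theorem statement2 (d : ℕ) (hd : 1 ≤ d)
    (ψ μ η : FreeAlgebra ℝ (Fin d) →ₗ[ℝ] ℝ)
    (hψstar : ∀ p, ψ (star p) = ψ p)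
    (hμstar : ∀ p, μ (star p) = μ p)
    (hψ1 : ψ 1 = 1)
    (hψpos : ∀ p, 0 ≤ ψ (star p * p))
    (hμpos : ∀ p, constTerm d p = 0 → 0 ≤ μ (star p * p))
    (hη1 : η 1 = 1)
    (hηword : ∀ (n : ℕ), 1 ≤ n → ∀ u : ℕ → Fin d,
      η (word d u 0 n) =
        ∑ Λ ∈ (Finset.range n).powerset.filter (fun Λ => 0 ∈ Λ ∧ n - 1 ∈ Λ),
          μ (((Λ.sort (· ≤ ·)).map fun i => FreeAlgebra.ι ℝ (u i)).prod) *
            ((List.zip (Λ.sort (· ≤ ·)) (Λ.sort (· ≤ ·)).tail).map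
              fun p => ψ (word d u (p.1 + 1) p.2)).prod) :
    ∀ p : FreeAlgebra ℝ (Fin d), constTerm d p = 0 → 0 ≤ η (star p * p) := by
  intro p hp
  set B := (gramForm ψ).tmul (gramForm μ)
  have hη : ∀ (i j : Fin d) (q : FreeAlgebra ℝ (Fin d)),
      η (FreeAlgebra.ι ℝ i * q * FreeAlgebra.ι ℝ j) =
        μ (FreeAlgebra.ι ℝ i * contract ψ (gapRep ψ q (1 ⊗ₜ FreeAlgebra.ι ℝ j))) := by
    intro i j q
    have key : η ∘ₗ LinearMap.mulRight ℝ (FreeAlgebra.ι ℝ j) ∘ₗ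
          LinearMap.mulLeft ℝ (FreeAlgebra.ι ℝ i) =
        μ ∘ₗ LinearMap.mulLeft ℝ (FreeAlgebra.ι ℝ i) ∘ₗ contract ψ ∘ₗ
          LinearMap.applyₗ (1 ⊗ₜ FreeAlgebra.ι ℝ j) ∘ₗ (gapRep ψ).toLinearMap := by
      refine linearMap_ext_words fun l => ?_
      set u : ℕ → Fin d := fun n => (i :: (l ++ [j])).getD n i
      have h0 : u 0 = i := rfl
      have hlast : u (l.length + 1) = j := by simp [u]
      have hmid : word d u 1 (l.length + 1) = (l.map (FreeAlgebra.ι ℝ)).prod := by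
        unfold word
        congr 1
        refine List.ext_getElem (by simp) fun n h₁ h₂ => ?_
        have hn : n < l.length := by simpa using h₂
        simp [u, add_comm 1 n, List.getElem?_append_left hn, hn]
      have hall : word d u 0 (l.length + 2) =
          FreeAlgebra.ι ℝ i * (l.map (FreeAlgebra.ι ℝ)).prod * FreeAlgebra.ι ℝ j := by
        rw [word_eq_mul u (by omega), h0, ← hmid, ← hlast, mul_assoc]
        congr 1
        simp [word, List.range'_concat, add_comm 1]
      have h := hηword (l.length + 2) (by omega) u
      rw [sum_subsets_eq, hall, hmid, h0, hlast] at h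
      simpa using h
    exact LinearMap.congr_fun key q
  have hB : ∀ (i : Fin d) t,
      B (1 ⊗ₜ FreeAlgebra.ι ℝ i) t = μ (FreeAlgebra.ι ℝ i * contract ψ t) := by
    intro i t
    induction t using TensorProduct.induction_on with
    | zero => simp
    | add t₁ t₂ h₁ h₂ => simp only [map_add, mul_add, h₁, h₂]
    | tmul a b => simp [B, mul_comm]
  obtain ⟨q, hq⟩ := exists_eq_constTerm_add_sum p
  rw [hp, map_zero, zero_add] at hq
  set T := ∑ i, gapRep ψ (q i) (1 ⊗ₜ FreeAlgebra.ι ℝ i)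
  have hT : η (star p * p) = B T T := by
    simp only [hq, T, star_sum, Finset.sum_mul, Finset.mul_sum, map_sum, LinearMap.sum_apply,
      star_mul, FreeAlgebra.star_ι]
    refine Finset.sum_congr rfl fun i _ => Finset.sum_congr rfl fun j _ => ?_
    rw [gapRep_adjoint μ hψstar, ← Module.End.mul_apply, ← map_mul, hB, ← hη]
    simp only [mul_assoc]
  rw [hT]
  refine tmul_self_nonneg_of_mem_range_lTensor _ _ (gramForm_symm hψstar) (gramForm_symm hμstar)
    (LinearMap.ker (constTerm d).toLinearMap) hψpos hμpos
    (Submodule.sum_mem _ fun i _ => gapRep_mem_range ψ _ _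
      ⟨1 ⊗ₜ ⟨FreeAlgebra.ι ℝ i, by simp [constTerm]⟩, rfl⟩)
end

section
/- Let (m_n)_{n≥0} be a positive definite sequence with m_0 = 1, m_1 = 0 and m_2 = 1; set M := Σ_{n≥1} m_n Xⁿ ∈ ℝ⟦X⟧ and η := M·(1+M)⁻¹. Then there exists a positive definite sequence (ψ_n)_{n≥0} with ψ_0 = 1 such that η = X²·(1 + Σ_{n≥1} ψ_n Xⁿ). (In one variable, the map Φ = Φ[SC(0,1), ·], which sends ψ to the distribution with Boolean cumulant generating function w²(1+M^ψ(w)), is onto the set of states with mean 0 and variance 1.) -/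
open PowerSeries

/-- A sequence is positive definite. -/
def PosDefSeq (m : ℕ → ℝ) : Prop :=
  ∀ (N : ℕ) (c : Fin N → ℝ),
    0 ≤ ∑ i : Fin N, ∑ j : Fin N, c i * c j * m ((i : ℕ) + (j : ℕ))

/-- The moment generating series `M = Σ_{n ≥ 1} m_n Xⁿ` of a moment sequence. -/
noncomputable def momentSeries (m : ℕ → ℝ) : ℝ⟦X⟧ :=
  PowerSeries.mk fun n => if n = 0 then 0 else m n

/-- The linear functional on real polynomials sending `xⁿ` to `m n`. -/
noncomputable def momentFunctional (m : ℕ → ℝ) : Polynomial ℝ →ₗ[ℝ] ℝ :=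
  Polynomial.lsum fun n => m n • LinearMap.id

theorem momentFunctional_C_mul_X_pow (m : ℕ → ℝ) (n : ℕ) (a : ℝ) :
    momentFunctional m (Polynomial.C a * Polynomial.X ^ n) = a * m n := by
  rw [Polynomial.C_mul_X_pow_eq_monomial, momentFunctional, Polynomial.lsum_apply,
    Polynomial.sum_monomial_index _ _ (by simp)]
  simp [mul_comm]

theorem momentFunctional_X_pow (m : ℕ → ℝ) (n : ℕ) :
    momentFunctional m (Polynomial.X ^ n) = m n := by
  simpa using momentFunctional_C_mul_X_pow m n 1

theorem momentFunctional_C (m : ℕ → ℝ) (a : ℝ) :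
    momentFunctional m (Polynomial.C a) = a * m 0 := by
  simpa using momentFunctional_C_mul_X_pow m 0 a

/-- The moment functional of a positive definite sequence is positive on squares. -/
theorem PosDefSeq.momentFunctional_mul_self_nonneg {m : ℕ → ℝ} (hm : PosDefSeq m)
    (p : Polynomial ℝ) : 0 ≤ momentFunctional m (p * p) := by
  have h := hm (p.natDegree + 1) fun i => p.coeff i
  convert h using 1
  conv_lhs => rw [p.as_sum_range_C_mul_X_pow, Finset.sum_mul_sum]
  simp only [map_sum]
  rw [Finset.sum_range]
  refine Finset.sum_congr rfl fun i _ => ?_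
  rw [Finset.sum_range]
  refine Finset.sum_congr rfl fun j _ => ?_
  rw [← momentFunctional_C_mul_X_pow, Polynomial.C_mul, pow_add]
  congr 1
  ring

/-- The orbit of `x` under multiplication by `x` followed by centering. -/
noncomputable def centeredOrbit (m : ℕ → ℝ) : ℕ → Polynomial ℝ
  | 0 => Polynomial.X
  | n + 1 => Polynomial.X * centeredOrbit m n -
      Polynomial.C (momentFunctional m (Polynomial.X * centeredOrbit m n))

/-- The Boolean cumulants, shifted by two, of a centered moment sequence. -/
noncomputable def shiftedBooleanCumulant (m : ℕ → ℝ) (n : ℕ) : ℝ :=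
  momentFunctional m (Polynomial.X * centeredOrbit m n)

theorem centeredOrbit_succ (m : ℕ → ℝ) (n : ℕ) :
    centeredOrbit m (n + 1) =
      Polynomial.X * centeredOrbit m n - Polynomial.C (shiftedBooleanCumulant m n) :=
  rfl

theorem momentFunctional_centeredOrbit {m : ℕ → ℝ} (hm0 : m 0 = 1) (hm1 : m 1 = 0) (n : ℕ) :
    momentFunctional m (centeredOrbit m n) = 0 := by
  cases n with
  | zero => simpa [centeredOrbit, hm1] using momentFunctional_X_pow m 1
  | succ n =>
    rw [centeredOrbit_succ, map_sub, momentFunctional_C, hm0, shiftedBooleanCumulant]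
    ring

/-- Compression of multiplication by `x` to the centered polynomials is symmetric. -/
theorem momentFunctional_centeredOrbit_mul {m : ℕ → ℝ} (hm0 : m 0 = 1) (hm1 : m 1 = 0)
    (i j : ℕ) :
    momentFunctional m (centeredOrbit m i * centeredOrbit m j) =
      shiftedBooleanCumulant m (i + j) := by
  have mul_succ (i j : ℕ) :
      momentFunctional m (centeredOrbit m i * centeredOrbit m (j + 1)) =
        momentFunctional m (Polynomial.X * (centeredOrbit m i * centeredOrbit m j)) := by
    have h : centeredOrbit m i * centeredOrbit m (j + 1) =
        Polynomial.X * (centeredOrbit m i * centeredOrbit m j) -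
          shiftedBooleanCumulant m j • centeredOrbit m i := by
      rw [centeredOrbit_succ, Polynomial.smul_eq_C_mul]
      ring
    rw [h, map_sub, map_smul, momentFunctional_centeredOrbit hm0 hm1, smul_zero, sub_zero]
  induction i generalizing j with
  | zero => simp [centeredOrbit, shiftedBooleanCumulant]
  | succ i ih =>
    rw [mul_comm, mul_succ, mul_comm (centeredOrbit m j), ← mul_succ, ih]
    congr 1
    ring

theorem posDefSeq_shiftedBooleanCumulant {m : ℕ → ℝ} (hm : PosDefSeq m)
    (hm0 : m 0 = 1) (hm1 : m 1 = 0) : PosDefSeq (shiftedBooleanCumulant m) := by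
  intro N c
  have h := hm.momentFunctional_mul_self_nonneg (∑ i : Fin N, c i • centeredOrbit m i)
  simpa [Finset.sum_mul_sum, momentFunctional_centeredOrbit_mul hm0 hm1, mul_assoc,
    mul_left_comm] using h

theorem centeredOrbit_succ_add_sum (m : ℕ → ℝ) (n : ℕ) :
    centeredOrbit m (n + 1) + ∑ p ∈ Finset.HasAntidiagonal.antidiagonal n,
      Polynomial.C (shiftedBooleanCumulant m p.1) * Polynomial.X ^ p.2 =
        Polynomial.X ^ (n + 2) := by
  induction n with
  | zero => rw [centeredOrbit_succ, centeredOrbit]; simp [pow_two]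
  | succ n ih =>
    rw [Finset.Nat.sum_antidiagonal_succ', pow_succ', ← ih, centeredOrbit_succ, mul_add,
      Finset.mul_sum]
    simp only [pow_succ', mul_left_comm Polynomial.X, pow_zero]
    ring

/-- The moment recursion through Boolean cumulants. -/
theorem moment_eq_sum_shiftedBooleanCumulant {m : ℕ → ℝ} (hm0 : m 0 = 1) (hm1 : m 1 = 0)
    (n : ℕ) :
    m (n + 2) = ∑ p ∈ Finset.HasAntidiagonal.antidiagonal n, shiftedBooleanCumulant m p.1 * m p.2 := by
  rw [← momentFunctional_X_pow m (n + 2), ← centeredOrbit_succ_add_sum, map_add, map_sum,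
    momentFunctional_centeredOrbit hm0 hm1, zero_add]
  simp only [momentFunctional_C_mul_X_pow]

theorem one_add_momentSeries {m : ℕ → ℝ} (hm0 : m 0 = 1) :
    1 + momentSeries m = PowerSeries.mk m := by
  ext n
  by_cases hn : n = 0 <;> simp [momentSeries, coeff_one, hn, hm0]

theorem statement12 (m : ℕ → ℝ) (hm : PosDefSeq m)
    (hm0 : m 0 = 1) (hm1 : m 1 = 0) (hm2 : m 2 = 1) :
    ∃ ψ : ℕ → ℝ, PosDefSeq ψ ∧ ψ 0 = 1 ∧
      momentSeries m * (1 + momentSeries m)⁻¹ =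
        X ^ 2 * (1 + momentSeries ψ) := by
  have hψ0 : shiftedBooleanCumulant m 0 = 1 := by
    rw [shiftedBooleanCumulant, centeredOrbit, ← pow_two, momentFunctional_X_pow, hm2]
  refine ⟨shiftedBooleanCumulant m, posDefSeq_shiftedBooleanCumulant hm hm0 hm1, hψ0, ?_⟩
  have hc : constantCoeff (PowerSeries.mk m) ≠ 0 := by
    simp [← coeff_zero_eq_constantCoeff_apply, hm0]
  rw [one_add_momentSeries hm0, one_add_momentSeries hψ0, eq_comm,
    PowerSeries.eq_mul_inv_iff_mul_eq hc, mul_assoc]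
  ext n
  match n with
  | 0 => simp [momentSeries]
  | 1 => simp [momentSeries, coeff_X_pow_mul', hm1]
  | n + 2 =>
    rw [coeff_X_pow_mul, coeff_mul]
    simp [momentSeries, moment_eq_sum_shiftedBooleanCumulant hm0 hm1]
end
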